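/- arXiv:2012.11805 — 2 statements merged into one kernel-verified Lean document; each statement's English description precedes it below -/
import Mathlib

section
/- Let P and Q be probability measures on a measurable space Ω. Then the Kullback–Leibler divergence admits the Donsker–Varadhan dual representation: D_KL(P ‖ Q) equals the supremum, over all measurable functions T : Ω → ℝ such that T is integrable with respect to P and e^T is integrable with respect to Q, of E_P[T] − log(E_Q[e^T]). -/
open MeasureTheory Real

open Classical in
/-- The Kullback–Leibler divergence of `P` with respect to `Q`: the integral
`∫ log (dP/dQ) dP` when `P ≪ Q` (and this integral is well defined, i.e. the
log-likelihood ratio is integrable), and `+∞` otherwise. -/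
noncomputable def klDiv {Ω : Type*} [MeasurableSpace Ω] (P Q : Measure Ω) : EReal :=
  if P ≪ Q ∧ Integrable (llr P Q) P then ((∫ ω, llr P Q ω ∂P : ℝ) : EReal) else ⊤

section DonskerVaradhan

variable {Ω : Type*} [MeasurableSpace Ω] {P Q : Measure Ω}
  [IsProbabilityMeasure P] [IsProbabilityMeasure Q]

/-- Gibbs variational inequality. -/
lemma integral_sub_log_integral_exp_le_integral_llr (hPQ : P ≪ Q) (hllr : Integrable (llr P Q) P)
    {T : Ω → ℝ} (hTP : Integrable T P) (hTQ : Integrable (fun ω => exp (T ω)) Q) :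
    ∫ ω, T ω ∂P - log (∫ ω, exp (T ω) ∂Q) ≤ ∫ ω, llr P Q ω ∂P := by
  have := isProbabilityMeasure_tilted hTQ
  have h := InformationTheory.integral_llr_add_sub_measure_univ_nonneg
    (hPQ.trans (absolutelyContinuous_tilted hTQ)) (integrable_llr_tilted_right hPQ hTP hllr hTQ)
  rw [integral_llr_tilted_right hPQ hTP hTQ hllr] at h
  simp only [probReal_univ] at h
  linarith

lemma integral_max_rnDeriv_le {ε : ℝ} (hε : 0 ≤ ε) :
    ∫ ω, max (P.rnDeriv Q ω).toReal ε ∂Q ≤ 1 + ε := by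
  have hp : Integrable (fun ω => (P.rnDeriv Q ω).toReal) Q := Measure.integrable_toReal_rnDeriv
  calc ∫ ω, max (P.rnDeriv Q ω).toReal ε ∂Q
      ≤ ∫ ω, ((P.rnDeriv Q ω).toReal + ε) ∂Q :=
        integral_mono (hp.sup (integrable_const ε)) (hp.add (integrable_const ε))
          fun ω => max_le_add_of_nonneg ENNReal.toReal_nonneg hε
    _ = ∫ ω, (P.rnDeriv Q ω).toReal ∂Q + ε := by
        rw [integral_add hp (integrable_const ε)]; simp
    _ ≤ 1 + ε := by
        gcongr
        simpa using Measure.setIntegral_toReal_rnDeriv_le (μ := P) (ν := Q) (s := Set.univ)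
          (measure_ne_top P _)

/-- The truncated log-likelihood ratio is almost optimal in the variational formula. -/
lemma exists_integral_llr_sub_log_le (hPQ : P ≪ Q) (hllr : Integrable (llr P Q) P)
    {ε : ℝ} (hε : 0 < ε) :
    ∃ T : Ω → ℝ, Measurable T ∧ Integrable T P ∧ Integrable (fun ω => exp (T ω)) Q ∧
      ∫ ω, llr P Q ω ∂P - log (1 + ε) ≤ ∫ ω, T ω ∂P - log (∫ ω, exp (T ω) ∂Q) := by
  have hexp : (fun ω => exp (log (max (P.rnDeriv Q ω).toReal ε))) =
      fun ω => max (P.rnDeriv Q ω).toReal ε :=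
    funext fun ω => exp_log (lt_max_of_lt_right hε)
  have hpos : ∀ᵐ ω ∂P, 0 < (P.rnDeriv Q ω).toReal := by
    filter_upwards [Measure.rnDeriv_pos hPQ, hPQ.ae_le (Measure.rnDeriv_lt_top P Q)] with ω h0 h1
    exact ENNReal.toReal_pos h0.ne' h1.ne
  have hmeas : Measurable fun ω => log (max (P.rnDeriv Q ω).toReal ε) := by fun_prop
  have hint : Integrable (fun ω => max (P.rnDeriv Q ω).toReal ε) Q :=
    Measure.integrable_toReal_rnDeriv.sup (integrable_const ε)
  have hTP : Integrable (fun ω => log (max (P.rnDeriv Q ω).toReal ε)) P := by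
    refine (hllr.sup (integrable_const (log ε))).congr ?_
    filter_upwards [hpos] with ω hω
    exact (strictMonoOn_log.monotoneOn.map_max hω hε).symm
  refine ⟨_, hmeas, hTP, hexp ▸ hint, ?_⟩
  rw [hexp]
  have h1 : ∫ ω, llr P Q ω ∂P ≤ ∫ ω, log (max (P.rnDeriv Q ω).toReal ε) ∂P := by
    refine integral_mono_ae hllr hTP ?_
    filter_upwards [hpos] with ω hω
    exact log_le_log hω (le_max_left _ _)
  have h2 : ε ≤ ∫ ω, max (P.rnDeriv Q ω).toReal ε ∂Q := by
    simpa using integral_mono (integrable_const (μ := Q) ε) hint fun ω => le_max_right _ _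
  have h3 := log_le_log (hε.trans_le h2) (integral_max_rnDeriv_le (P := P) (Q := Q) hε.le)
  linarith

/-- If the Donsker–Varadhan functional is bounded above, then `P ≪ Q`. -/
lemma absolutelyContinuous_of_integral_sub_log_integral_exp_le {C : ℝ}
    (hC : ∀ T : Ω → ℝ, Measurable T → Integrable T P → Integrable (fun ω => exp (T ω)) Q →
      ∫ ω, T ω ∂P - log (∫ ω, exp (T ω) ∂Q) ≤ C) : P ≪ Q := by
  refine Measure.AbsolutelyContinuous.mk fun A hA hQA => ?_
  have hexp (c : ℝ) : (fun ω => exp (A.indicator (fun _ => c) ω)) =ᵐ[Q] fun _ => 1 := by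
    filter_upwards [measure_eq_zero_iff_ae_notMem.mp hQA] with ω hω
    simp [hω]
  have hle (c : ℝ) : P.real A * c ≤ C := by
    have h := hC (A.indicator fun _ => c) (measurable_const.indicator hA)
      ((integrable_const c).indicator hA) ((integrable_const 1).congr (hexp c).symm)
    rw [integral_congr_ae (hexp c)] at h
    simpa [integral_indicator_const c hA] using h
  by_contra hPA
  have hPA' : 0 < P.real A := ENNReal.toReal_pos hPA (measure_ne_top P A)
  have h := hle ((C + 1) / P.real A)
  rw [mul_div_cancel₀ _ hPA'.ne'] at h
  linarith

/-- If the Donsker–Varadhan functional is bounded above, then the log-likelihood ratio is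
integrable. -/
lemma integrable_llr_of_integral_sub_log_integral_exp_le (hPQ : P ≪ Q) {C : ℝ}
    (hC : ∀ T : Ω → ℝ, Measurable T → Integrable T P → Integrable (fun ω => exp (T ω)) Q →
      ∫ ω, T ω ∂P - log (∫ ω, exp (T ω) ∂Q) ≤ C) : Integrable (llr P Q) P := by
  set L : Ω → ℝ := fun ω => log (max (P.rnDeriv Q ω).toReal 1) with hL
  have hLm : Measurable L := by fun_prop
  have hL0 (ω : Ω) : 0 ≤ L ω := log_nonneg (le_max_right _ _)
  have hmax : Integrable (fun ω => max (P.rnDeriv Q ω).toReal 1) Q :=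
    Measure.integrable_toReal_rnDeriv.sup (integrable_const 1)
  have htrunc (n : ℕ) : Integrable (fun ω => min (L ω) n) P := by
    refine Integrable.of_bound (C := n) (by fun_prop) (ae_of_all _ fun ω => ?_)
    rw [norm_of_nonneg (le_min (hL0 ω) n.cast_nonneg)]
    exact min_le_right _ _
  have hexp (n : ℕ) (ω : Ω) : exp (min (L ω) n) ≤ max (P.rnDeriv Q ω).toReal 1 :=
    (exp_le_exp.2 (min_le_left _ _)).trans_eq (exp_log (lt_max_of_lt_right one_pos))
  have hexp_int (n : ℕ) : Integrable (fun ω => exp (min (L ω) n)) Q := by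
    refine hmax.mono' (by fun_prop) (ae_of_all _ fun ω => ?_)
    rw [norm_of_nonneg (exp_pos _).le]
    exact hexp n ω
  have hbound (n : ℕ) : ∫ ω, min (L ω) n ∂P ≤ C + log 2 := by
    have h1 : ∫ ω, exp (min (L ω) n) ∂Q ≤ 2 :=
      (integral_mono (hexp_int n) hmax (hexp n)).trans
        ((integral_max_rnDeriv_le zero_le_one).trans_eq one_add_one_eq_two)
    have h2 := log_le_log (integral_exp_pos (hexp_int n)) h1
    have h3 := hC _ (by fun_prop) (htrunc n) (hexp_int n)
    linarith
  have hLP : Integrable L P := by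
    refine ⟨hLm.aestronglyMeasurable, ?_⟩
    rw [hasFiniteIntegral_iff_ofReal (ae_of_all _ hL0)]
    have hsup (ω : Ω) : ENNReal.ofReal (L ω) = ⨆ n : ℕ, ENNReal.ofReal (min (L ω) n) := by
      refine le_antisymm ?_ (iSup_le fun n => ENNReal.ofReal_le_ofReal (min_le_left _ _))
      obtain ⟨n, hn⟩ := exists_nat_ge (L ω)
      exact le_iSup_of_le n (by rw [min_eq_left hn])
    simp_rw [hsup]
    rw [lintegral_iSup (f := fun (n : ℕ) ω => ENNReal.ofReal (min (L ω) n))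
      (fun n => by fun_prop) fun m n hmn ω =>
      ENNReal.ofReal_le_ofReal (min_le_min_left _ (Nat.cast_le.2 hmn))]
    refine (iSup_le fun n => ?_).trans_lt (ENNReal.ofReal_lt_top (r := C + log 2))
    rw [← ofReal_integral_eq_lintegral_ofReal (htrunc n)
      (ae_of_all _ fun ω => le_min (hL0 ω) n.cast_nonneg)]
    exact ENNReal.ofReal_le_ofReal (hbound n)
  rw [← integrable_rnDeriv_mul_log_iff hPQ]
  have hLQ : Integrable (fun ω => (P.rnDeriv Q ω).toReal * L ω) Q :=
    (integrable_rnDeriv_smul_iff hPQ).2 hLP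
  refine (hLQ.add (integrable_const 1)).mono' (by fun_prop) (ae_of_all _ fun ω => ?_)
  have hp : 0 ≤ (P.rnDeriv Q ω).toReal := ENNReal.toReal_nonneg
  simp only [hL, Pi.add_apply, norm_eq_abs]
  rcases le_total (P.rnDeriv Q ω).toReal 1 with h | h
  · rw [max_eq_right h, log_one, mul_zero, zero_add, mul_comm]
    rcases hp.eq_or_lt with h0 | h0
    · simp [← h0]
    · exact (abs_log_mul_self_lt _ h0 h).le
  · rw [max_eq_left h, abs_of_nonneg (mul_nonneg hp (log_nonneg h))]
    linarith

end DonskerVaradhan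

/-- **Donsker–Varadhan dual representation** of the Kullback–Leibler divergence:
`D_KL(P ‖ Q)` is the supremum, over all measurable functions `T : Ω → ℝ` with `T`
integrable with respect to `P` and `e^T` integrable with respect to `Q`, of
`E_P[T] − log (E_Q[e^T])`. -/
theorem klDiv_eq_iSup_donsker_varadhan {Ω : Type*} [MeasurableSpace Ω]
    (P Q : Measure Ω) [IsProbabilityMeasure P] [IsProbabilityMeasure Q] :
    klDiv P Q =
      ⨆ T : {T : Ω → ℝ // Measurable T ∧ Integrable T P ∧
          Integrable (fun ω => Real.exp (T ω)) Q},
        ((∫ ω, T.1 ω ∂P - Real.log (∫ ω, Real.exp (T.1 ω) ∂Q) : ℝ) : EReal) := by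
  refine le_antisymm ?_ (iSup_le fun T => ?_)
  · refine EReal.le_of_forall_lt_iff_le.1 fun C hC => ?_
    have hbound (T : Ω → ℝ) (hT : Measurable T) (hTP : Integrable T P)
        (hTQ : Integrable (fun ω => exp (T ω)) Q) :
        ∫ ω, T ω ∂P - log (∫ ω, exp (T ω) ∂Q) ≤ C :=
      EReal.coe_le_coe_iff.1 ((le_iSup_of_le ⟨T, hT, hTP, hTQ⟩ le_rfl).trans hC.le)
    have hPQ := absolutelyContinuous_of_integral_sub_log_integral_exp_le hbound
    have hllr := integrable_llr_of_integral_sub_log_integral_exp_le hPQ hbound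
    rw [klDiv, if_pos ⟨hPQ, hllr⟩, EReal.coe_le_coe_iff]
    refine le_of_forall_pos_le_add fun ε hε => ?_
    obtain ⟨T, hT, hTP, hTQ, h⟩ := exists_integral_llr_sub_log_le hPQ hllr hε
    have h1 := hbound T hT hTP hTQ
    have h2 := log_le_sub_one_of_pos (by linarith : 0 < 1 + ε)
    linarith
  · by_cases h : P ≪ Q ∧ Integrable (llr P Q) P
    · rw [klDiv, if_pos h, EReal.coe_le_coe_iff]
      exact integral_sub_log_integral_exp_le_integral_llr h.1 h.2 T.2.2.1 T.2.2.2
    · rw [klDiv, if_neg h]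
      exact le_top
end

section
/- Let P and Q be probability measures on a measurable space Ω, and let T : Ω → ℝ be a measurable function such that T is integrable with respect to P and e^T is integrable with respect to Q. Then D_KL(P ‖ Q) ≥ E_P[T] − log(E_Q[e^T]). In particular, any such function T yields a lower bound on the Kullback–Leibler divergence. -/
open MeasureTheory Real

/-- **Donsker–Varadhan lower bound**: for any measurable `T : Ω → ℝ` with `T`
integrable with respect to `P` and `e^T` integrable with respect to `Q`, the
quantity `E_P[T] − log (E_Q[e^T])` is a lower bound on `D_KL(P ‖ Q)`. -/
theorem le_klDiv_donsker_varadhan {Ω : Type*} [MeasurableSpace Ω]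
    (P Q : Measure Ω) [IsProbabilityMeasure P] [IsProbabilityMeasure Q]
    (T : Ω → ℝ) (hT : Measurable T) (hTP : Integrable T P)
    (hTQ : Integrable (fun ω => Real.exp (T ω)) Q) :
    klDiv P Q ≥
      ((∫ ω, T ω ∂P - Real.log (∫ ω, Real.exp (T ω) ∂Q) : ℝ) : EReal) := by
  unfold klDiv
  split_ifs with h
  · obtain ⟨hPQ, hllr⟩ := h
    have : IsProbabilityMeasure (Q.tilted T) := isProbabilityMeasure_tilted hTQ
    have h_gibbs := InformationTheory.integral_llr_add_sub_measure_univ_nonneg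
      (hPQ.trans (absolutelyContinuous_tilted hTQ))
      (integrable_llr_tilted_right hPQ hTP hllr hTQ)
    rw [integral_llr_tilted_right hPQ hTP hTQ hllr] at h_gibbs
    simp only [probReal_univ] at h_gibbs
    exact EReal.coe_le_coe_iff.mpr (by linarith)
  · exact le_top
end
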